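/- arXiv:1406.0154 — 2 statements merged into one kernel-verified Lean document; each statement's English description precedes it below -/
import Mathlib

section
/- Let G be a bipartite distance hereditary graph with color classes X and Y and no universal vertices, and let B(G) be the set of maximal bicliques of G with both shores nonempty. Then the bipartite incidence graph on color classes Y and B(G), in which y ∈ Y is adjacent to B ∈ B(G) iff y belongs to the Y-shore of B, is bipartite distance hereditary; likewise, the bipartite incidence graph on color classes X and B(G), in which x ∈ X is adjacent to B ∈ B(G) iff x belongs to the X-shore of B, is bipartite distance hereditary. -/
open SimpleGraph

variable {V : Type*}

/-- `X`, `Y` form a bipartition of the simple graph `G`. -/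
def IsBipartition (G : SimpleGraph V) (X Y : Set V) : Prop :=
  Disjoint X Y ∧ X ∪ Y = Set.univ ∧
    ∀ ⦃u v : V⦄, G.Adj u v → (u ∈ X ∧ v ∈ Y) ∨ (u ∈ Y ∧ v ∈ X)

/-- `G` is distance hereditary. -/
def DistHereditary (G : SimpleGraph V) : Prop :=
  ∀ (S : Set V) (u v : S), (G.induce S).Reachable u v →
    (G.induce S).dist u v = G.dist ↑u ↑v

def IsBiclique (G : SimpleGraph V) (X Y A B : Set V) : Prop :=
  A ⊆ X ∧ B ⊆ Y ∧ ∀ a ∈ A, ∀ b ∈ B, G.Adj a b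

def IsMaxBiclique (G : SimpleGraph V) (X Y A B : Set V) : Prop :=
  IsBiclique G X Y A B ∧
    ∀ A' B', IsBiclique G X Y A' B' → A ⊆ A' → B ⊆ B' → A = A' ∧ B = B'

/-- The maximal bicliques of `G` with both shores nonempty. -/
def MaxBicliques (G : SimpleGraph V) (X Y : Set V) : Set (Set V × Set V) :=
  {p | IsMaxBiclique G X Y p.1 p.2 ∧ p.1.Nonempty ∧ p.2.Nonempty}

/-- `q` covers `p` in the poset of maximal bicliques with nonempty shores,
ordered by inclusion of `X`-shores. -/
def Covers (G : SimpleGraph V) (X Y : Set V) (p q : Set V × Set V) : Prop :=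
  p ∈ MaxBicliques G X Y ∧ q ∈ MaxBicliques G X Y ∧ p.1 ⊂ q.1 ∧
    ∀ r ∈ MaxBicliques G X Y, ¬ (p.1 ⊂ r.1 ∧ r.1 ⊂ q.1)

/-- The Hasse graph of the poset of maximal bicliques with nonempty shores. -/
def HasseGraph (G : SimpleGraph V) (X Y : Set V) :
    SimpleGraph (MaxBicliques G X Y) :=
  SimpleGraph.fromRel (fun p q => Covers G X Y p.val q.val)

def NoUniversalVertex (G : SimpleGraph V) (X Y : Set V) : Prop :=
  (∀ x ∈ X, ∃ y ∈ Y, ¬ G.Adj x y) ∧ (∀ y ∈ Y, ∃ x ∈ X, ¬ G.Adj y x)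

def deleteVert (G : SimpleGraph V) (v : V) : SimpleGraph V :=
  SimpleGraph.fromRel (fun a b => G.Adj a b ∧ a ≠ v ∧ b ≠ v)

def domino : SimpleGraph (Fin 6) :=
  SimpleGraph.fromRel (fun i j => j = i + 1 ∨ (i = 0 ∧ j = 3))

def DominoFree (G : SimpleGraph V) : Prop :=
  ¬ ∃ f : Fin 6 → V, Function.Injective f ∧
      ∀ i j, domino.Adj i j ↔ G.Adj (f i) (f j)

def cycleGraph' (n : ℕ) : SimpleGraph (ZMod n) :=
  SimpleGraph.fromRel (fun i j => j = i + 1)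

def HasInducedCycle (G : SimpleGraph V) (n : ℕ) : Prop :=
  ∃ f : ZMod n → V, Function.Injective f ∧
      ∀ i j, (cycleGraph' n).Adj i j ↔ G.Adj (f i) (f j)

def Chordal (G : SimpleGraph V) : Prop := ∀ n, 4 ≤ n → ¬ HasInducedCycle G n

def Ptolemaic (G : SimpleGraph V) : Prop := Chordal G ∧ DistHereditary G

def MaxCliques (G : SimpleGraph V) : Set (Set V) :=
  {S | G.IsClique S ∧ ∀ T, G.IsClique T → S ⊆ T → S = T}

def cliqueIncidence (G : SimpleGraph V) :
    SimpleGraph (V ⊕ ↥(MaxCliques G)) :=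
  SimpleGraph.fromRel (fun a b =>
    match a, b with
    | Sum.inl v, Sum.inr K => v ∈ K.val
    | _, _ => False)

def incidenceY (G : SimpleGraph V) (X Y : Set V) :
    SimpleGraph (↥Y ⊕ ↥(MaxBicliques G X Y)) :=
  SimpleGraph.fromRel (fun a b =>
    match a, b with
    | Sum.inl y, Sum.inr B => (y : V) ∈ B.val.2
    | _, _ => False)

def incidenceX (G : SimpleGraph V) (X Y : Set V) :
    SimpleGraph (↥X ⊕ ↥(MaxBicliques G X Y)) :=
  SimpleGraph.fromRel (fun a b =>
    match a, b with
    | Sum.inl x, Sum.inr B => (x : V) ∈ B.val.1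
    | _, _ => False)

def starGraph (G : SimpleGraph V) (v v' : V) : SimpleGraph (Option V) :=
  SimpleGraph.fromRel (fun a b =>
    match a, b with
    | some a, some b => G.Adj a b
    | none, some b => G.Adj v b ∧ G.Adj v' b
    | _, _ => False)

/-- Whenever two vertices have a common neighbour, every walk `p` between them can be replaced by a
walk of length at most two through vertices of `p`. -/
def ShortcutsTwoStep (G : SimpleGraph V) : Prop :=
  ∀ ⦃u c v : V⦄, G.Adj u c → G.Adj c v → ∀ p : G.Walk u v,
    ∃ q : G.Walk u v, q.length ≤ 2 ∧ q.support ⊆ p.support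

theorem ShortcutsTwoStep.exists_walk_length_le {G : SimpleGraph V} (hG : ShortcutsTwoStep G)
    {u v : V} (w p : G.Walk u v) :
    ∃ q : G.Walk u v, q.length ≤ w.length ∧ q.support ⊆ p.support := by
  classical
  induction w with
  | nil => exact ⟨.nil, le_rfl, by simp⟩
  | @cons u c v h w ih =>
    by_cases hc : c ∈ p.support
    · obtain ⟨q, hq, hqs⟩ := ih (p.dropUntil c hc)
      refine ⟨.cons h q, by simpa using hq, ?_⟩
      rw [Walk.support_cons]
      exact List.cons_subset.2 ⟨p.start_mem_support,
        fun x hx => p.support_dropUntil_subset_support hc (hqs hx)⟩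
    · obtain ⟨q, hq, hqs⟩ := ih (.cons h.symm p)
      have hpath := q.bypass_isPath
      have hlen := q.length_bypass_le_length
      have hsub := q.support_bypass_subset_support
      generalize q.bypass = q' at hpath hlen hsub
      cases q' with
      | nil => exact absurd p.end_mem_support hc
      | @cons _ r _ h' t =>
        rw [Walk.cons_isPath_iff] at hpath
        have ht : t.support ⊆ p.support := fun x hx => by
          have := hqs (hsub (t.support_subset_support_cons h' hx))
          rw [Walk.support_cons, List.mem_cons] at this
          rcases this with rfl | this
          · exact absurd hx hpath.2
          · exact this
        have hr := ht t.start_mem_support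
        obtain ⟨s, hs, hss⟩ := hG h h' (p.takeUntil r hr)
        refine ⟨s.append t, ?_, fun x hx => ?_⟩
        · simp only [Walk.length_append, Walk.length_cons] at hlen ⊢
          omega
        · rcases (Walk.mem_support_append_iff _ _).1 hx with hx | hx
          · exact p.support_takeUntil_subset_support hr (hss hx)
          · exact ht hx

theorem ShortcutsTwoStep.distHereditary {G : SimpleGraph V} (hG : ShortcutsTwoStep G) :
    DistHereditary G := by
  intro S u v huv
  obtain ⟨p, hp⟩ := huv.exists_walk_length_eq_dist
  let p' : G.Walk u v := p.map (Embedding.induce S).toHom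
  obtain ⟨w, hw⟩ := p'.reachable.exists_walk_length_eq_dist
  obtain ⟨q, hq, hqs⟩ := hG.exists_walk_length_le w p'
  apply le_antisymm
  · have hS : ∀ x ∈ q.support, x ∈ S := fun x hx => by
      obtain ⟨y, -, rfl⟩ := List.mem_map.1 (Walk.support_map _ p ▸ hqs hx)
      exact y.2
    have hlen : (q.induce S hS).length = q.length := by
      rw [← Walk.length_map (Embedding.induce S).toHom, Walk.map_induce]
      rfl
    exact (dist_le (q.induce S hS)).trans (hlen.le.trans (hq.trans hw.le))
  · rw [← hp, ← p.length_map (Embedding.induce S).toHom]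
    exact dist_le p'

theorem DistHereditary.exists_common_neighbor_mem_support {G : SimpleGraph V}
    (hG : DistHereditary G) {u c v : V} (huc : G.Adj u c) (hcv : G.Adj c v) (hne : u ≠ v)
    (huv : ¬ G.Adj u v) (p : G.Walk u v) : ∃ d ∈ p.support, G.Adj u d ∧ G.Adj d v := by
  let S : Set V := {x | x ∈ p.support}
  let p' := p.induce S fun x hx => hx
  obtain ⟨q, hq⟩ := p'.reachable.exists_walk_length_eq_dist
  have hle : G.dist u v ≤ 2 := dist_le (Walk.cons huc (Walk.cons hcv .nil))
  have hlen : q.length ≤ 2 := by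
    rw [hq, hG S _ _ p'.reachable]
    exact hle
  clear hq
  cases q with
  | nil => exact absurd rfl hne
  | @cons _ d _ h q =>
    cases q with
    | nil => exact absurd h huv
    | cons h' q =>
      cases q with
      | nil => exact ⟨d, d.2, h, h'⟩
      | cons _ q =>
        simp only [Walk.length_cons] at hlen
        omega

theorem exists_walk_to_first {G : SimpleGraph V} (Q : V → Prop) {u v : V} (p : G.Walk u v)
    (hv : Q v) : ∃ (w : V) (q : G.Walk u w),
      Q w ∧ q.support ⊆ p.support ∧ ∀ z ∈ q.support, Q z → z = w := by
  induction p with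
  | nil => exact ⟨_, .nil, hv, by simp, by simp⟩
  | @cons u c v h p ih =>
    by_cases hu : Q u
    · exact ⟨u, .nil, hu, by simp, by simp⟩
    · obtain ⟨w, q, hw, hqs, hq⟩ := ih hv
      refine ⟨w, .cons h q, hw, ?_, fun z hz hQz => ?_⟩
      · simp only [Walk.support_cons]
        exact List.cons_subset_cons _ hqs
      · rw [Walk.support_cons, List.mem_cons] at hz
        rcases hz with rfl | hz
        · exact absurd hQz hu
        · exact hq z hz hQz

/-- In a distance hereditary graph, two intersecting sets of common neighbours are separated by
their intersection. -/
theorem DistHereditary.exists_mem_support_common {G : SimpleGraph V} (hG : DistHereditary G)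
    {A B : Set V} (hAB : ∀ a ∈ A, ∀ b ∈ B, ¬ G.Adj a b) {c : V} (hcA : ∀ a ∈ A, G.Adj c a)
    (hcB : ∀ b ∈ B, G.Adj c b) {y z : V} (hy : ∀ a ∈ A, G.Adj y a) (hz : ∀ b ∈ B, G.Adj z b)
    (p : G.Walk y z) :
    ∃ x ∈ p.support, (∀ a ∈ A, G.Adj x a) ∧ ∀ b ∈ B, G.Adj x b := by
  by_contra! hp
  obtain ⟨w, q, hw, hqs, hq⟩ := exists_walk_to_first (fun x => ∀ a ∈ A, G.Adj x a) p.reverse hy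
  have hqp : ∀ x ∈ q.support, x ∈ p.support := fun x hx => by simpa using hqs hx
  obtain ⟨b, hb, hwb⟩ := hp w (hqp w q.end_mem_support) hw
  obtain ⟨t, r, ht, hrs, hr⟩ := exists_walk_to_first (fun x => G.Adj x b) q.reverse (hz b hb)
  have htq : t ∈ q.support := by simpa using hrs r.end_mem_support
  obtain ⟨a, ha, hta⟩ : ∃ a ∈ A, ¬ G.Adj t a := by
    by_contra! h
    exact hwb (hq t htq h ▸ ht)
  have hne : a ≠ b := fun h => hwb (h ▸ hw a ha)
  obtain ⟨d, hd, had, hdb⟩ := hG.exists_common_neighbor_mem_support (hcA a ha).symm (hcB b hb) hne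
    (hAB a ha b hb) (.cons (hw a ha).symm (r.concat ht))
  simp only [Walk.support_cons, Walk.support_concat, List.mem_cons,
    List.mem_append, List.not_mem_nil, or_false] at hd
  rcases hd with rfl | hd | rfl
  · exact G.irrefl had
  · exact hta (hr d hd hdb ▸ had.symm)
  · exact G.irrefl hdb

/-- The incidence graph between a stable set `T` and the common neighbourhoods in `T` of nonempty
sets `A i` whose union is stable is distance hereditary whenever the ambient graph is. -/
theorem DistHereditary.incidence {G : SimpleGraph V} (hG : DistHereditary G) {T : Set V}
    (hT : ∀ u ∈ T, ∀ v ∈ T, ¬ G.Adj u v) {ι : Type*} {A : ι → Set V}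
    (hne : ∀ i, (A i).Nonempty) (hA : ∀ i j, ∀ a ∈ A i, ∀ b ∈ A j, ¬ G.Adj a b)
    {I : SimpleGraph (T ⊕ ι)} (hI : ∀ y i, I.Adj (.inl y) (.inr i) ↔ ∀ a ∈ A i, G.Adj y a)
    (hl : ∀ y z, ¬ I.Adj (.inl y) (.inl z)) (hr : ∀ i j, ¬ I.Adj (.inr i) (.inr j)) :
    DistHereditary I := by
  classical
  have hom : ∀ f : ι → V, (∀ i, f i ∈ A i) →
      ∃ F : I →g G, (∀ y, F (.inl y) = y) ∧ ∀ i, F (.inr i) = f i := fun f hf =>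
    ⟨⟨Sum.elim Subtype.val f, by
      rintro (y | i) (z | j) h
      · exact absurd h (hl _ _)
      · exact (hI _ _).1 h _ (hf j)
      · exact ((hI _ _).1 h.symm _ (hf i)).symm
      · exact absurd h (hr _ _)⟩, fun _ => rfl, fun _ => rfl⟩
  have short : ∀ {u v : T ⊕ ι} {p : I.Walk u v} {d : T ⊕ ι}, d ∈ p.support → I.Adj u d →
      I.Adj d v → ∃ q : I.Walk u v, q.length ≤ 2 ∧ q.support ⊆ p.support :=
    fun {_ _ p _} hd h h' => ⟨.cons h (.cons h' .nil), by simp, by simp [hd]⟩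
  apply ShortcutsTwoStep.distHereditary
  rintro u c v huc hcv p
  by_cases huv : u = v
  · subst huv
    exact ⟨.nil, by simp, by simp⟩
  rcases u with y | i <;> rcases c with c | c <;> rcases v with z | j
  case inl.inl.inl | inl.inl.inr => exact absurd huc (hl _ _)
  case inr.inr.inl | inr.inr.inr => exact absurd huc (hr _ _)
  case inl.inr.inr => exact absurd hcv (hr _ _)
  case inr.inl.inl => exact absurd hcv (hl _ _)
  case inl.inr.inl =>
    have key : ∀ i, ∃ a ∈ A i, G.Adj y a → G.Adj z a →
        I.Adj (.inl y) (.inr i) ∧ I.Adj (.inl z) (.inr i) := by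
      intro i
      simp only [hI]
      by_contra! h
      obtain ⟨a, ha⟩ := hne i
      obtain ⟨b, hb, hzb⟩ := (h a ha).2.2 fun b hb => (h b hb).1
      exact hzb (h b hb).2.1
    choose f hf hfadj using key
    obtain ⟨F, hFl, hFr⟩ := hom f hf
    have hyz : F (.inl y) ≠ F (.inl z) := by
      rw [hFl, hFl]
      exact fun h => huv (congrArg _ (Subtype.ext h))
    have hnadj : ¬ G.Adj (F (.inl y)) (F (.inl z)) := by
      rw [hFl, hFl]
      exact hT _ y.2 _ z.2
    obtain ⟨d, hd, hyd, hdz⟩ := hG.exists_common_neighbor_mem_support (F.map_adj huc)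
      (F.map_adj hcv) hyz hnadj (p.map F)
    rw [Walk.support_map, List.mem_map] at hd
    obtain ⟨x | k, hx, rfl⟩ := hd
    · rw [hFl, hFl] at hyd
      exact absurd hyd (hT _ y.2 _ x.2)
    · rw [hFl, hFr] at hyd
      rw [hFl, hFr] at hdz
      obtain ⟨h, h'⟩ := hfadj k hyd hdz.symm
      exact short hx h h'.symm
  case inr.inl.inr =>
    choose f hf using hne
    obtain ⟨F, hFl, hFr⟩ := hom f hf
    have hnil : ¬ p.Nil := p.not_nil_of_ne huv
    have ends : ∀ {k : ι} {x : T ⊕ ι}, I.Adj x (.inr k) → ∀ a ∈ A k, G.Adj (F x) a := by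
      rintro k (x | l) h
      · rw [hFl]
        exact (hI _ _).1 h
      · exact absurd h (hr _ _)
    let q := (p.takeUntil _ (p.getVert_mem_support 1)).reverse.append
      (p.takeUntil _ (p.getVert_mem_support (p.length - 1)))
    obtain ⟨x, hx, hxi, hxj⟩ := hG.exists_mem_support_common (hA i j) (ends huc.symm) (ends hcv)
      (ends (p.adj_snd hnil).symm) (ends (p.adj_penultimate hnil)) (q.map F)
    rw [Walk.support_map, List.mem_map] at hx
    obtain ⟨x, hx, rfl⟩ := hx
    have hxp : x ∈ p.support := by
      rcases (Walk.mem_support_append_iff _ _).1 hx with h | h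
      · rw [Walk.support_reverse, List.mem_reverse] at h
        exact p.support_takeUntil_subset_support _ h
      · exact p.support_takeUntil_subset_support _ h
    rcases x with x | k
    · rw [hFl] at hxi hxj
      exact short hxp ((hI _ _).2 hxi).symm ((hI _ _).2 hxj)
    · rw [hFr] at hxi
      exact absurd (hxi _ (hf i)) (hA k i _ (hf k) _ (hf i))

theorem IsBipartition.not_adj_left {G : SimpleGraph V} {X Y : Set V} (h : IsBipartition G X Y) :
    ∀ u ∈ X, ∀ v ∈ X, ¬ G.Adj u v := fun u hu v hv huv => by
  rcases h.2.2 huv with ⟨-, hv'⟩ | ⟨hu', -⟩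
  · exact Set.disjoint_left.1 h.1 hv hv'
  · exact Set.disjoint_left.1 h.1 hu hu'

theorem IsBipartition.symm {G : SimpleGraph V} {X Y : Set V} (h : IsBipartition G X Y) :
    IsBipartition G Y X :=
  ⟨h.1.symm, Set.union_comm X Y ▸ h.2.1, fun _ _ huv => (h.2.2 huv).symm⟩

theorem IsBiclique.swap {G : SimpleGraph V} {X Y A B : Set V} (h : IsBiclique G X Y A B) :
    IsBiclique G Y X B A :=
  ⟨h.2.1, h.1, fun b hb a ha => (h.2.2 a ha b hb).symm⟩

theorem IsMaxBiclique.swap {G : SimpleGraph V} {X Y A B : Set V} (h : IsMaxBiclique G X Y A B) :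
    IsMaxBiclique G Y X B A :=
  ⟨h.1.swap, fun B' A' h' hB hA => (h.2 A' B' h'.swap hA hB).symm⟩

theorem IsMaxBiclique.mem_right_iff {G : SimpleGraph V} {X Y A B : Set V}
    (h : IsMaxBiclique G X Y A B) {y : V} (hy : y ∈ Y) : y ∈ B ↔ ∀ a ∈ A, G.Adj y a := by
  refine ⟨fun hyB a ha => (h.1.2.2 a ha y hyB).symm, fun hyA => ?_⟩
  rw [(h.2 A (insert y B) ⟨h.1.1, Set.insert_subset hy h.1.2.1, ?_⟩ le_rfl
    (Set.subset_insert y B)).2]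
  · exact Set.mem_insert y B
  · rintro a ha b (rfl | hb)
    · exact (hyA a ha).symm
    · exact h.1.2.2 a ha b hb

theorem isBipartition_range_inl_range_inr {α β : Type*} {I : SimpleGraph (α ⊕ β)}
    (hl : ∀ y z, ¬ I.Adj (.inl y) (.inl z)) (hr : ∀ i j, ¬ I.Adj (.inr i) (.inr j)) :
    IsBipartition I (Set.range Sum.inl) (Set.range Sum.inr) := by
  refine ⟨Set.isCompl_range_inl_range_inr.disjoint, Set.range_inl_union_range_inr, ?_⟩
  rintro (y | i) (z | j) h
  · exact absurd h (hl _ _)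
  · exact .inl ⟨⟨y, rfl⟩, ⟨j, rfl⟩⟩
  · exact .inr ⟨⟨i, rfl⟩, ⟨z, rfl⟩⟩
  · exact absurd h (hr _ _)

/-- For a BDH graph with no universal vertices, the bipartite
incidence graphs of the maximal bicliques (with nonempty shores) over `Y`
and over `X` are both bipartite distance hereditary. -/
theorem incidence_graphs_BDH [Fintype V] (G : SimpleGraph V) (X Y : Set V)
    (hbip : IsBipartition G X Y) (hDH : DistHereditary G)
    (huniv : NoUniversalVertex G X Y) :
    (IsBipartition (incidenceY G X Y) (Set.range Sum.inl) (Set.range Sum.inr) ∧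
        DistHereditary (incidenceY G X Y)) ∧
      (IsBipartition (incidenceX G X Y) (Set.range Sum.inl) (Set.range Sum.inr) ∧
        DistHereditary (incidenceX G X Y)) := by
  constructor
  · have hl : ∀ y z, ¬ (incidenceY G X Y).Adj (.inl y) (.inl z) := by simp [incidenceY]
    have hr : ∀ i j, ¬ (incidenceY G X Y).Adj (.inr i) (.inr j) := by simp [incidenceY]
    refine ⟨isBipartition_range_inl_range_inr hl hr,
      hDH.incidence hbip.symm.not_adj_left (A := fun B => B.val.1) (fun B => B.2.2.1)
        (fun B C a ha c hc => hbip.not_adj_left a (B.2.1.1.1 ha) c (C.2.1.1.1 hc))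
        (fun y B => ?_) hl hr⟩
    rw [← B.2.1.mem_right_iff y.2]
    simp [incidenceY]
  · have hl : ∀ y z, ¬ (incidenceX G X Y).Adj (.inl y) (.inl z) := by simp [incidenceX]
    have hr : ∀ i j, ¬ (incidenceX G X Y).Adj (.inr i) (.inr j) := by simp [incidenceX]
    refine ⟨isBipartition_range_inl_range_inr hl hr,
      hDH.incidence hbip.not_adj_left (A := fun B => B.val.2) (fun B => B.2.2.2)
        (fun B C a ha c hc => hbip.symm.not_adj_left a (B.2.1.1.2.1 ha) c (C.2.1.1.2.1 hc))
        (fun x B => ?_) hl hr⟩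
    rw [← B.2.1.swap.mem_right_iff x.2]
    simp [incidenceX]
end

section
/- Let G be a connected bipartite distance hereditary graph with color classes X and Y and at least three vertices, and let x ∈ X. Then x is a cut-vertex of G (i.e., the graph obtained from G by deleting x is disconnected) if and only if ({x}, N(x)) is a maximal biclique of G (equivalently, there is no vertex x' ∈ X with x' ≠ x and N(x) ⊆ N(x')). -/
open SimpleGraph

variable {V : Type*}

/-- In a distance hereditary graph, two distinct nonadjacent vertices that have a common neighbor
and are joined by a path inside `S` have a common neighbor inside `S`. -/
lemma DistHereditary.exists_common_neighbor_mem {G : SimpleGraph V} (hDH : DistHereditary G)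
    {S : Set V} {u v w : V} (hu : u ∈ S) (hv : v ∈ S)
    (hreach : (G.induce S).Reachable ⟨u, hu⟩ ⟨v, hv⟩) (huw : G.Adj u w) (hwv : G.Adj w v)
    (hne : u ≠ v) (hnadj : ¬ G.Adj u v) : ∃ z ∈ S, G.Adj u z ∧ G.Adj z v := by
  have hle : G.dist u v ≤ 2 := dist_le (Walk.cons huw (Walk.cons hwv Walk.nil))
  obtain ⟨p, hp⟩ := hreach.exists_walk_length_eq_dist
  rw [hDH S _ _ hreach] at hp
  replace hp : p.length ≤ 2 := hp ▸ hle
  cases p with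
  | nil => exact absurd rfl hne
  | @cons _ z _ h p =>
    cases p with
    | nil => exact absurd h hnadj
    | cons h' p =>
      cases p with
      | nil => exact ⟨z, z.2, h, h'⟩
      | cons h'' p => simp only [Walk.length_cons] at hp; omega

/-- Deleting a vertex whose neighborhood is contained in that of another vertex keeps a connected
graph connected. -/
lemma connected_induce_ne_of_neighborSet_subset {G : SimpleGraph V} (hconn : G.Connected)
    {x x' : V} (hne : x' ≠ x) (hsub : G.neighborSet x ⊆ G.neighborSet x') :
    (G.induce {u : V | u ≠ x}).Connected := by
  classical
  let f : G →g G.induce {u : V | u ≠ x} :=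
    { toFun := fun u => if h : u = x then ⟨x', hne⟩ else ⟨u, h⟩
      map_rel' := by
        intro a b hab
        by_cases ha : a = x
        · subst ha
          have hb : b ≠ a := hab.ne'
          simpa [hb] using hsub hab
        · by_cases hb : b = x
          · subst hb
            simpa [ha] using (hsub hab.symm).symm
          · simpa [ha, hb] using hab }
  have hf : ∀ u : {u : V | u ≠ x}, f u = u := fun u => dif_neg u.2
  have : Nonempty {u : V | u ≠ x} := ⟨⟨x', hne⟩⟩
  refine ⟨fun u v => ?_⟩
  rw [← hf u, ← hf v]
  exact (hconn.preconnected u v).map f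

/-- In a bipartition, all neighbors of a vertex of the first class lie in the second class. -/
lemma IsBipartition.mem_right {G : SimpleGraph V} {X Y : Set V} (h : IsBipartition G X Y)
    {u v : V} (hu : u ∈ X) (huv : G.Adj u v) : v ∈ Y := by
  rcases h.2.2 huv with h' | h'
  · exact h'.2
  · exact absurd h'.1 (Set.disjoint_left.1 h.1 hu)

/-- In a bipartition, all neighbors of a vertex of the second class lie in the first class. -/
lemma IsBipartition.mem_left {G : SimpleGraph V} {X Y : Set V} (h : IsBipartition G X Y)
    {u v : V} (hu : u ∈ Y) (huv : G.Adj u v) : v ∈ X := by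
  rcases h.2.2 huv with h' | h'
  · exact absurd hu (Set.disjoint_left.1 h.1 h'.1)
  · exact h'.2

lemma IsBipartition.not_adj_of_mem_right {G : SimpleGraph V} {X Y : Set V}
    (h : IsBipartition G X Y) {u v : V} (hu : u ∈ Y) (hv : v ∈ Y) : ¬ G.Adj u v :=
  fun huv => Set.disjoint_left.1 h.1 (h.mem_left hu huv) hv

/-- If deleting `x` keeps a bipartite distance hereditary graph connected, then some other vertex
is adjacent to all neighbors of `x`. -/
lemma exists_neighborSet_subset_of_connected_induce_ne [Finite V] {G : SimpleGraph V}
    {X Y : Set V} (hbip : IsBipartition G X Y) (hDH : DistHereditary G) {x y₀ : V} (hx : x ∈ X)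
    (hxy₀ : G.Adj x y₀) (hnt : Nontrivial {u : V | u ≠ x})
    (hconn : (G.induce {u : V | u ≠ x}).Connected) :
    ∃ x', x' ≠ x ∧ G.neighborSet x ⊆ G.neighborSet x' := by
  obtain ⟨⟨x₀, hx₀⟩, hy₀x₀⟩ :=
    hconn.preconnected.exists_adj_of_nontrivial (⟨y₀, hxy₀.ne'⟩ : {u : V | u ≠ x})
  replace hy₀x₀ : G.Adj y₀ x₀ := hy₀x₀
  have : Nonempty {u : V | u ≠ x} := ⟨⟨x₀, hx₀⟩⟩
  obtain ⟨⟨x', hx'⟩, hmax⟩ := Finite.exists_max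
    fun u : {u : V | u ≠ x} => (G.neighborSet x ∩ G.neighborSet u).ncard
  refine ⟨x', hx', fun y hxy => ?_⟩
  by_contra hx'y
  replace hxy : G.Adj x y := hxy
  replace hx'y : ¬ G.Adj x' y := hx'y
  obtain ⟨y₁, hxy₁, hx'y₁⟩ : (G.neighborSet x ∩ G.neighborSet x').Nonempty := by
    rw [← Set.ncard_pos (Set.toFinite _)]
    refine lt_of_lt_of_le ?_ (hmax ⟨x₀, hx₀⟩)
    rw [Set.ncard_pos (Set.toFinite _)]
    exact ⟨y₀, hxy₀, hy₀x₀.symm⟩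
  replace hxy₁ : G.Adj x y₁ := hxy₁
  replace hx'y₁ : G.Adj x' y₁ := hx'y₁
  have hyY := hbip.mem_right hx hxy
  have hy₁Y := hbip.mem_right hx hxy₁
  obtain ⟨x'', hx'', hyx'', hx''y₁⟩ := hDH.exists_common_neighbor_mem hxy.ne' hxy₁.ne'
    (hconn.preconnected _ _) hxy.symm hxy₁ (by rintro rfl; exact hx'y hx'y₁)
    (hbip.not_adj_of_mem_right hyY hy₁Y)
  obtain ⟨y₂, hxy₂, hx'y₂, hx''y₂⟩ : ∃ y₂, G.Adj x y₂ ∧ G.Adj x' y₂ ∧ ¬ G.Adj x'' y₂ := by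
    by_contra! hcon
    refine absurd (hmax ⟨x'', hx''⟩) (not_le.2 (Set.ncard_lt_ncard ?_ (Set.toFinite _)))
    refine Set.ssubset_iff_exists.2
      ⟨fun z hz => ⟨hz.1, hcon z hz.1 hz.2⟩, y, ⟨hxy, hyx''.symm⟩, fun hy => hx'y hy.2⟩
  have hy₂Y := hbip.mem_right hx hxy₂
  let S : Set V := {y, x'', y₁, x', y₂}
  have hreach : (G.induce S).Reachable ⟨y, by simp [S]⟩ ⟨y₂, by simp [S]⟩ := by
    refine (Adj.reachable (v := ⟨x'', by simp [S]⟩) hyx'').trans ?_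
    refine (Adj.reachable (v := ⟨y₁, by simp [S]⟩) hx''y₁).trans ?_
    refine (Adj.reachable (v := ⟨x', by simp [S]⟩) hx'y₁.symm).trans ?_
    exact Adj.reachable hx'y₂
  obtain ⟨z, hz, hyz, hzy₂⟩ := hDH.exists_common_neighbor_mem _ _ hreach hxy.symm hxy₂
    (by rintro rfl; exact hx'y hx'y₂) (hbip.not_adj_of_mem_right hyY hy₂Y)
  rcases hz with rfl | rfl | rfl | rfl | rfl
  · exact hyz.ne rfl
  · exact hx''y₂ hzy₂
  · exact hbip.not_adj_of_mem_right hyY hy₁Y hyz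
  · exact hx'y hyz.symm
  · exact hzy₂.ne rfl

/-- In a connected BDH graph with at least three vertices, a
vertex `x ∈ X` is a cut-vertex iff `({x}, N(x))` is a maximal biclique. -/
theorem cutVertex_iff_star_maxBiclique [Fintype V] (G : SimpleGraph V)
    (X Y : Set V) (hbip : IsBipartition G X Y) (hDH : DistHereditary G)
    (hconn : G.Connected) (hcard : 3 ≤ Fintype.card V) (x : V) (hx : x ∈ X) :
    ¬ (G.induce {u : V | u ≠ x}).Connected ↔
      IsMaxBiclique G X Y {x} (G.neighborSet x) := by
  constructor
  · intro hcut
    refine ⟨⟨by simpa using hx, fun y hy => hbip.mem_right hx hy, ?_⟩, ?_⟩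
    · rintro a rfl b hb
      exact hb
    · intro A' B' hAB hA hB
      have hB' : G.neighborSet x = B' :=
        hB.antisymm fun b hb => hAB.2.2 x (hA rfl) b hb
      refine ⟨hA.antisymm fun a ha => ?_, hB'⟩
      by_contra hne
      exact hcut (connected_induce_ne_of_neighborSet_subset hconn hne
        fun b hb => hAB.2.2 a ha b (hB hb))
  · intro hmax hconn'
    have : Nontrivial V := Fintype.one_lt_card_iff_nontrivial.1 (by omega)
    obtain ⟨y, hxy⟩ := hconn.preconnected.exists_adj_of_nontrivial x
    have hnt : Nontrivial {u : V | u ≠ x} := by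
      classical
      rw [← Fintype.one_lt_card_iff_nontrivial]
      have := Set.card_ne_eq x
      omega
    obtain ⟨x', hne, hsub⟩ :=
      exists_neighborSet_subset_of_connected_induce_ne hbip hDH hx hxy hnt hconn'
    have hx'X : x' ∈ X := hbip.mem_left (hbip.mem_right hx hxy) (hsub hxy).symm
    have h := (hmax.2 {x, x'} (G.neighborSet x) ⟨?_, hmax.1.2.1, ?_⟩ (by simp) subset_rfl).1
    · exact hne (h.ge (Set.mem_insert_of_mem x rfl))
    · rintro a (rfl | rfl) <;> assumption
    · rintro a (rfl | rfl) b hb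
      · exact hb
      · exact hsub hb
end
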